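/- Let X be a compact Hausdorff space, U ⊆ X an open subset, and C_0(U) := {f ∈ C(X,ℂ) : f vanishes on X ∖ U}. For every C(X,ℂ)-linear map φ : C_0(U) → C(X,ℂ) (not assumed continuous) there is a unique bounded continuous function g : U → ℂ such that for all f ∈ C_0(U): φ(f)(x) = g(x)·f(x) for every x ∈ U, and φ(f)(x) = 0 for every x ∈ X ∖ U. Moreover, the assignment g ↦ (f ↦ g·f extended by zero) is a bijection from the bounded continuous functions on U onto the set of C(X,ℂ)-linear maps C_0(U) → C(X,ℂ). -/

import Mathlib

/-- The ideal of continuous functions vanishing on the subset `Y`. -/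
noncomputable def IY {X : Type*} [TopologicalSpace X] (Y : Set X) : Ideal C(X, ℂ) where
  carrier := {f : C(X, ℂ) | ∀ y ∈ Y, f y = 0}
  add_mem' := by
    intro a b ha hb y hy
    simp [ha y hy, hb y hy]
  zero_mem' := by
    intro y hy
    simp
  smul_mem' := by
    intro c f hf y hy
    simp [hf y hy]

open Topology

/-- Urysohn functions supported in an open set, with values in `[0, 1]`. -/
theorem exists_urysohn_of_mem_isOpen {X : Type*} [TopologicalSpace X] [CompactSpace X] [T2Space X]
    {U : Set X} (hU : IsOpen U) {x : X} (hx : x ∈ U) :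
    ∃ e : C(X, ℝ), e x = 1 ∧ (∀ y ∉ U, e y = 0) ∧ ∀ y, e y ∈ Set.Icc (0 : ℝ) 1 := by
  obtain ⟨e, h0, h1, h⟩ := exists_continuous_zero_one_of_isClosed hU.isClosed_compl
    (isClosed_singleton (x := x)) (by simpa using hx)
  exact ⟨e, h1 rfl, fun y hy => h0 hy, h⟩

/-- A real continuous function, viewed as a complex one. -/
noncomputable def complexify {X : Type*} [TopologicalSpace X] (e : C(X, ℝ)) : C(X, ℂ) :=
  ⟨fun x => (e x : ℂ), by fun_prop⟩

@[simp] theorem complexify_apply {X : Type*} [TopologicalSpace X] (e : C(X, ℝ)) (x : X) :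
    complexify e x = (e x : ℂ) := rfl

theorem continuous_div_sqrt_norm : Continuous fun z : ℂ => z / (Real.sqrt ‖z‖ : ℂ) := by
  rw [continuous_iff_continuousAt]
  intro z
  by_cases hz : z = 0
  · subst hz
    have h : Filter.Tendsto (fun z : ℂ => Real.sqrt ‖z‖) (𝓝 0) (𝓝 0) := by
      have : Continuous fun z : ℂ => Real.sqrt ‖z‖ := by fun_prop
      simpa using this.tendsto 0
    simp only [ContinuousAt, zero_div]
    refine squeeze_zero_norm (fun z => ?_) h
    rw [norm_div, Complex.norm_real, Real.norm_of_nonneg (Real.sqrt_nonneg _), Real.div_sqrt]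
  · refine ContinuousAt.div continuousAt_id (by fun_prop) ?_
    simpa [Real.sqrt_eq_zero'] using hz

section Multiplier

variable {X : Type*} [TopologicalSpace X] {Y U : Set X}

/-- Linearity over `C(X, ℂ)` lets one exchange the roles of two elements of the ideal. -/
theorem IY.mul_map_comm (φ : (IY Y : Ideal C(X, ℂ)) →ₗ[C(X, ℂ)] C(X, ℂ))
    (f h : (IY Y : Ideal C(X, ℂ))) (x : X) :
    (f : C(X, ℂ)) x * φ h x = (h : C(X, ℂ)) x * φ f x := by
  have key : (f : C(X, ℂ)) • h = (h : C(X, ℂ)) • f := Subtype.ext (mul_comm _ _)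
  have := congrArg φ key
  rw [map_smul, map_smul] at this
  exact DFunLike.congr_fun this x

/-- Every module map sends the ideal into itself, as each element of the ideal is a product of
two elements of the ideal. -/
theorem IY.map_apply_eq_zero (φ : (IY Y : Ideal C(X, ℂ)) →ₗ[C(X, ℂ)] C(X, ℂ))
    (f : (IY Y : Ideal C(X, ℂ))) {x : X} (hx : x ∈ Y) : φ f x = 0 := by
  let s : C(X, ℂ) := ⟨fun y => (Real.sqrt ‖(f : C(X, ℂ)) y‖ : ℂ), by fun_prop⟩
  let k : (IY Y : Ideal C(X, ℂ)) :=
    ⟨⟨fun y => (f : C(X, ℂ)) y / (Real.sqrt ‖(f : C(X, ℂ)) y‖ : ℂ),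
      continuous_div_sqrt_norm.comp (f : C(X, ℂ)).continuous⟩, fun y hy => by
        simp [f.2 y hy]⟩
  have hf : f = s • k := by
    ext y
    by_cases hy : (f : C(X, ℂ)) y = 0
    · simp [s, k, hy]
    · have : (Real.sqrt ‖(f : C(X, ℂ)) y‖ : ℂ) ≠ 0 := by
        simpa [Real.sqrt_eq_zero'] using hy
      exact (mul_div_cancel₀ _ this).symm
  have hs : s x = 0 := by simp [s, f.2 x hx]
  rw [hf, map_smul]
  simp [hs]

/-- A function which multiplies `C_0(U)` into `C(X, ℂ)` is continuous. -/
theorem IY.continuous_of_mul [CompactSpace X] [T2Space X] (hU : IsOpen U) {g : U → ℂ}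
    (φ : (IY Uᶜ : Ideal C(X, ℂ)) → C(X, ℂ))
    (h : ∀ f (x : U), φ f (x : X) = g x * (f : C(X, ℂ)) (x : X)) : Continuous g := by
  rw [continuous_iff_continuousAt]
  intro x
  obtain ⟨e, hex, he0, -⟩ := exists_urysohn_of_mem_isOpen hU x.2
  let E : (IY Uᶜ : Ideal C(X, ℂ)) := ⟨complexify e, fun y hy => by simp [he0 y hy]⟩
  have hE : (E : C(X, ℂ)) (x : X) ≠ 0 := by simp [E, hex]
  have hcE : Continuous fun y : U => (E : C(X, ℂ)) (y : X) := by fun_prop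
  have hc : ContinuousAt (fun y : U => φ E (y : X) / (E : C(X, ℂ)) (y : X)) x :=
    ContinuousAt.div (by fun_prop) hcE.continuousAt hE
  refine hc.congr ?_
  filter_upwards [hcE.continuousAt.eventually_ne hE] with y hy
  rw [h, mul_div_cancel_right₀ _ hy]

/-- A function which multiplies `C_0(U)` into `C(X, ℂ)` is bounded. -/
theorem IY.bounded_of_mul [CompactSpace X] [T2Space X] (hU : IsOpen U) {g : U → ℂ}
    (φ : (IY Uᶜ : Ideal C(X, ℂ)) → C(X, ℂ))
    (h : ∀ f (x : U), φ f (x : X) = g x * (f : C(X, ℂ)) (x : X)) : ∃ C, ∀ x, ‖g x‖ ≤ C := by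
  by_contra! hg
  choose x hx using fun n : ℕ => hg (4 ^ n)
  choose e hex he0 he using fun n => exists_urysohn_of_mem_isOpen hU (x n).2
  have hle : ∀ n y, (1 / 2 : ℝ) ^ n * e n y ≤ (1 / 2) ^ n := fun n y =>
    mul_le_of_le_one_right (by positivity) (he n y).2
  have hnn : ∀ n y, 0 ≤ (1 / 2 : ℝ) ^ n * e n y := fun n y =>
    mul_nonneg (by positivity) (he n y).1
  let F : C(X, ℝ) := ⟨fun y => ∑' n, (1 / 2 : ℝ) ^ n * e n y,
    continuous_tsum (fun n => by fun_prop) summable_geometric_two fun n y => by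
      rw [Real.norm_of_nonneg (hnn n y)]; exact hle n y⟩
  let f : (IY Uᶜ : Ideal C(X, ℂ)) := ⟨complexify F, fun y hy => by
    simp [F, fun n => he0 n y hy]⟩
  have hF : ∀ n, (1 / 2 : ℝ) ^ n ≤ F (x n) := fun n => by
    have hs : Summable fun m => (1 / 2 : ℝ) ^ m * e m (x n) :=
      summable_geometric_two.of_nonneg_of_le (fun m => hnn m _) fun m => hle m _
    simpa [F, hex] using hs.le_tsum n fun m _ => hnn m _
  obtain ⟨n, hn⟩ := pow_unbounded_of_one_lt ‖φ f‖ (one_lt_two : (1 : ℝ) < 2)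
  have hb : ‖g (x n)‖ * F (x n) ≤ ‖φ f‖ := by
    have h1 := (φ f).norm_coe_le_norm (x n)
    rw [h, norm_mul] at h1
    refine le_trans (mul_le_mul_of_nonneg_left ?_ (norm_nonneg _)) h1
    simpa [f] using le_abs_self (F (x n))
  have h4 : (4 : ℝ) ^ n * (1 / 2) ^ n ≤ ‖g (x n)‖ * F (x n) :=
    mul_le_mul (hx n).le (hF n) (by positivity) (norm_nonneg _)
  rw [← mul_pow] at h4
  norm_num at h4
  linarith

open Classical in
/-- The product of a bounded continuous function on `U` with an element of `C_0(U)`, extended by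
zero. -/
noncomputable def IY.extendMul (hU : IsOpen U) (g : BoundedContinuousFunction U ℂ)
    (f : (IY Uᶜ : Ideal C(X, ℂ))) : C(X, ℂ) where
  toFun x := if hx : x ∈ U then g ⟨x, hx⟩ * (f : C(X, ℂ)) x else 0
  continuous_toFun := by
    rw [continuous_iff_continuousAt]
    intro x
    by_cases hx : x ∈ U
    · have hc : ContinuousOn
          (fun x => if hx : x ∈ U then g ⟨x, hx⟩ * (f : C(X, ℂ)) x else 0) U := by
        rw [continuousOn_iff_continuous_domRestrict]
        have : Continuous fun y : U => g y * (f : C(X, ℂ)) (y : X) := by fun_prop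
        convert this using 2 with y
        simp
      exact hc.continuousAt (hU.mem_nhds hx)
    · have hf : Filter.Tendsto (fun y => ‖g‖ * ‖(f : C(X, ℂ)) y‖) (𝓝 x) (𝓝 0) := by
        have : Continuous fun y => ‖g‖ * ‖(f : C(X, ℂ)) y‖ := by fun_prop
        simpa [f.2 x hx] using this.tendsto x
      simp only [ContinuousAt, hx, dite_false]
      refine squeeze_zero_norm (fun y => ?_) hf
      split_ifs with hy
      · rw [norm_mul]
        exact mul_le_mul_of_nonneg_right (g.norm_coe_le_norm _) (norm_nonneg _)
      · rw [norm_zero]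
        positivity

theorem IY.extendMul_apply_mem (hU : IsOpen U) (g : BoundedContinuousFunction U ℂ)
    (f : (IY Uᶜ : Ideal C(X, ℂ))) (x : U) :
    IY.extendMul hU g f (x : X) = g x * (f : C(X, ℂ)) (x : X) := by
  simp [IY.extendMul]

theorem IY.extendMul_apply_notMem (hU : IsOpen U) (g : BoundedContinuousFunction U ℂ)
    (f : (IY Uᶜ : Ideal C(X, ℂ))) {x : X} (hx : x ∉ U) : IY.extendMul hU g f x = 0 := by
  simp [IY.extendMul, hx]

/-- Multiplication by a bounded continuous function on `U`, as a module map on `C_0(U)`. -/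
noncomputable def IY.multiplier (hU : IsOpen U) (g : BoundedContinuousFunction U ℂ) :
    (IY Uᶜ : Ideal C(X, ℂ)) →ₗ[C(X, ℂ)] C(X, ℂ) where
  toFun := IY.extendMul hU g
  map_add' f h := by
    ext x
    by_cases hx : x ∈ U
    · simp [IY.extendMul, hx, mul_add]
    · simp [IY.extendMul, hx]
  map_smul' c f := by
    ext x
    by_cases hx : x ∈ U
    · simp [IY.extendMul, hx, mul_left_comm]
    · simp [IY.extendMul, hx]

end Multiplier

/-- Multipliers: for open `U ⊆ X` (`X` compact Hausdorff) and the ideal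
`C_0(U) = I_{X∖U}`, every `C(X,ℂ)`-linear map `φ : C_0(U) → C(X,ℂ)` (not
assumed continuous) is given by multiplication by a unique bounded continuous
`g : U → ℂ` (with values `0` off `U`), and conversely every bounded continuous
`g` arises from a unique such `φ`; i.e. the correspondence is a bijection. -/
theorem stmt17 {X : Type*} [TopologicalSpace X] [CompactSpace X] [T2Space X]
    (U : Set X) (hU : IsOpen U) :
    (∀ φ : (IY Uᶜ : Ideal C(X, ℂ)) →ₗ[C(X, ℂ)] C(X, ℂ),
      ∃! g : BoundedContinuousFunction U ℂ,
        ∀ f : (IY Uᶜ : Ideal C(X, ℂ)),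
          (∀ x : U, φ f (x : X) = g x * (f : C(X, ℂ)) (x : X)) ∧
          (∀ x : X, x ∉ U → φ f x = 0)) ∧
    (∀ g : BoundedContinuousFunction U ℂ,
      ∃! φ : (IY Uᶜ : Ideal C(X, ℂ)) →ₗ[C(X, ℂ)] C(X, ℂ),
        ∀ f : (IY Uᶜ : Ideal C(X, ℂ)),
          (∀ x : U, φ f (x : X) = g x * (f : C(X, ℂ)) (x : X)) ∧
          (∀ x : X, x ∉ U → φ f x = 0)) := by
  constructor
  · intro φ
    choose e hex he0 _ using fun x : U => exists_urysohn_of_mem_isOpen hU x.2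
    let E : U → (IY Uᶜ : Ideal C(X, ℂ)) := fun x =>
      ⟨complexify (e x), fun y hy => by simp [he0 x y hy]⟩
    have hE : ∀ x : U, (E x : C(X, ℂ)) (x : X) = 1 := fun x => by simp [E, hex]
    have hmul : ∀ f (x : U), φ f (x : X) = φ (E x) (x : X) * (f : C(X, ℂ)) (x : X) := by
      intro f x
      have := IY.mul_map_comm φ (E x) f x
      rwa [hE, one_mul, mul_comm] at this
    obtain ⟨C, hC⟩ := IY.bounded_of_mul hU φ hmul
    refine ⟨BoundedContinuousFunction.ofNormedAddCommGroup _
      (IY.continuous_of_mul hU φ hmul) C hC,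
      fun f => ⟨hmul f, fun x hx => IY.map_apply_eq_zero φ f hx⟩, fun g hg => ?_⟩
    ext x
    have := (hg (E x)).1 x
    rw [hE, mul_one] at this
    exact this.symm
  · intro g
    refine ⟨IY.multiplier hU g, fun f => ⟨IY.extendMul_apply_mem hU g f,
      fun x hx => IY.extendMul_apply_notMem hU g f hx⟩, fun φ hφ => ?_⟩
    ext f x
    by_cases hx : x ∈ U
    · exact ((hφ f).1 ⟨x, hx⟩).trans (IY.extendMul_apply_mem hU g f ⟨x, hx⟩).symm
    · exact ((hφ f).2 x hx).trans (IY.extendMul_apply_notMem hU g f hx).symm
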